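/- arXiv:alg-geom/9412009 — 2 statements merged into one kernel-verified Lean document; each statement's English description precedes it below -/
import Mathlib

section
/- Order the set nbc of standard ordered nbc-bases of 𝒜 lexicographically: (H_{i_1},…,H_{i_r}) ≺ (H_{j_1},…,H_{j_r}) iff (i_1,…,i_r) precedes (j_1,…,j_r) lexicographically. Then this is a shelling order of the broken circuit complex: for every B ∈ nbc and every B' ∈ nbc with B' ≺ B, there exist B'' ∈ nbc with B'' ≺ B and a hyperplane H ∈ B ∖ B' such that (as sets) B ∩ B' ⊆ B ∖ {H} and B ∩ B'' = B ∖ {H}. -/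
open Module

noncomputable section

/-- An arrangement of `n` (affine) hyperplanes inside the ambient affine subspace `amb`
of the complex vector space `W`.  The linear order on the hyperplanes is the order of the
indices in `Fin n`; an arbitrary linear order is encoded by a permutation `σ` of `Fin n`,
with `i ≺ j ↔ σ i < σ j`. -/
structure HArr (W : Type) [AddCommGroup W] [Module ℂ W] (n : ℕ) where
  amb : AffineSubspace ℂ W
  amb_ne : (amb : Set W).Nonempty
  H : Fin n → AffineSubspace ℂ W
  inj : Function.Injective H
  le_amb : ∀ i, H i ≤ amb
  nonemptyH : ∀ i, ((H i : Set W)).Nonempty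
  hyp : ∀ i, finrank ℂ (H i).direction + 1 = finrank ℂ amb.direction

namespace HArr

variable {W : Type} [AddCommGroup W] [Module ℂ W] {n : ℕ}

/-- The intersection `⋂ S` of a subset of the arrangement (the ambient space for `S = ∅`). -/
def inter (A : HArr W n) (S : Finset (Fin n)) : AffineSubspace ℂ W :=
  A.amb ⊓ S.inf A.H

/-- Codimension (inside the ambient space) of an affine subspace. -/
def cd (A : HArr W n) (X : AffineSubspace ℂ W) : ℕ :=
  finrank ℂ A.amb.direction - finrank ℂ X.direction

/-- A dependent subset of the arrangement. -/
def dep (A : HArr W n) (S : Finset (Fin n)) : Prop :=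
  A.inter S ≠ ⊥ ∧ A.cd (A.inter S) < S.card

/-- An independent subset of the arrangement. -/
def indep (A : HArr W n) (S : Finset (Fin n)) : Prop :=
  A.inter S ≠ ⊥ ∧ A.cd (A.inter S) = S.card

/-- A base: a maximal independent subset. -/
def isBase (A : HArr W n) (S : Finset (Fin n)) : Prop :=
  A.indep S ∧ ∀ T, A.indep T → S ⊆ T → S = T

open scoped Classical in
/-- The rank of a subarrangement `{H i : i ∈ C}`. -/
def rankOn (A : HArr W n) (C : Finset (Fin n)) : ℕ :=
  C.powerset.sup fun S => if A.indep S then S.card else 0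

/-- The rank `r` of the arrangement. -/
def rank (A : HArr W n) : ℕ := A.rankOn Finset.univ

/-- A circuit: an inclusion-minimal dependent set. -/
def circuit (A : HArr W n) (S : Finset (Fin n)) : Prop :=
  A.dep S ∧ ∀ T ⊂ S, ¬ A.dep T

/-- A broken circuit w.r.t. the linear order given by `σ`. -/
def brokenCircuit (A : HArr W n) (σ : Equiv.Perm (Fin n)) (S : Finset (Fin n)) : Prop :=
  ∃ i ∉ S, (∀ j ∈ S, σ i < σ j) ∧ A.circuit (insert i S)

/-- An nbc set: nonempty intersection and containing no broken circuit. -/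
def nbcSet (A : HArr W n) (σ : Equiv.Perm (Fin n)) (S : Finset (Fin n)) : Prop :=
  A.inter S ≠ ⊥ ∧ ∀ T ⊆ S, ¬ A.brokenCircuit σ T

/-- An nbc-base. -/
def nbcBase (A : HArr W n) (σ : Equiv.Perm (Fin n)) (S : Finset (Fin n)) : Prop :=
  A.nbcSet σ S ∧ A.isBase S

/-- A βnbc-base. -/
def betaNbcBase (A : HArr W n) (σ : Equiv.Perm (Fin n)) (S : Finset (Fin n)) : Prop :=
  A.nbcBase σ S ∧ ∀ i ∈ S, ∃ j, σ j < σ i ∧ A.isBase (insert j (S.erase i))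

/-- Membership in the intersection poset `L(𝒜)`. -/
def memL (A : HArr W n) (X : AffineSubspace ℂ W) : Prop :=
  X ≠ ⊥ ∧ ∃ S : Finset (Fin n), A.inter S = X

/-- A maximal element of `L(𝒜)` (in the reverse-inclusion order). -/
def maximalL (A : HArr W n) (X : AffineSubspace ℂ W) : Prop :=
  A.memL X ∧ ∀ Y, A.memL Y → Y ≤ X → Y = X

open scoped Classical in
/-- The set of indices of hyperplanes containing `X`, i.e. `𝒜_X`. -/
def sub (A : HArr W n) (X : AffineSubspace ℂ W) : Finset (Fin n) :=
  Finset.univ.filter fun i => X ≤ A.H i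

/-- `X` is dense: `𝒜_X` admits no decomposition into two nonempty parts. -/
def denseL (A : HArr W n) (X : AffineSubspace ℂ W) : Prop :=
  ¬ ∃ S T : Finset (Fin n), Disjoint S T ∧ S.Nonempty ∧ T.Nonempty ∧
      S ∪ T = A.sub X ∧ A.cd (A.inter S) + A.cd (A.inter T) = A.cd X

/-- `i` is the minimum of `S` w.r.t. the linear order given by `σ`. -/
def isMin (σ : Equiv.Perm (Fin n)) (i : Fin n) (S : Finset (Fin n)) : Prop :=
  i ∈ S ∧ ∀ j ∈ S, σ i ≤ σ j

/-- The standard ordered tuple of a finite set, w.r.t. the linear order given by `σ`: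
`tup σ S p` is the element of `S` with `(p+1)`-st smallest `σ`-value. -/
def tup (σ : Equiv.Perm (Fin n)) (S : Finset (Fin n)) (p : Fin S.card) : Fin n :=
  σ.symm (((S.image ⇑σ).orderIsoOfFin (Finset.card_image_of_injective S σ.injective) p).1)

/-- The flag `ξ(B) = (X_1 > ⋯ > X_r)` of a standard ordered base:
`flag σ S p = X_{p+1} = ⋂_{k ≥ p} H_{i_k}`. -/
def flag (A : HArr W n) (σ : Equiv.Perm (Fin n)) (S : Finset (Fin n)) (p : Fin S.card) :
    AffineSubspace ℂ W :=
  A.inter (S.filter fun i => σ (tup σ S p) ≤ σ i)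

/-- Lexicographic order on standard ordered tuples (for the canonical order). -/
def lexLt (S T : Finset (Fin n)) : Prop :=
  List.Lex (· < ·) (S.sort (· ≤ ·)) (T.sort (· ≤ ·))

/-- `λ(X) = Σ_{H_i ∈ 𝒜_X} λ_i`. -/
def lamX (A : HArr W n) (lam : Fin n → ℂ) (X : AffineSubspace ℂ W) : ℂ :=
  ∑ i ∈ A.sub X, lam i

/-- `X` is unmixed (w.r.t. the order `σ`). -/
def unmixedX (A : HArr W n) (σ : Equiv.Perm (Fin n)) (X : AffineSubspace ℂ W) : Prop :=
  (∀ S, A.nbcBase σ S → A.inter S = X → A.betaNbcBase σ S) ∨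
  (∀ S, A.nbcBase σ S → A.inter S = X → ¬ A.betaNbcBase σ S)

/-- The linear order given by `σ` is unmixed. -/
def unmixedOrd (A : HArr W n) (σ : Equiv.Perm (Fin n)) : Prop :=
  ∀ X, A.maximalL X → A.unmixedX σ X

/-- Membership in the intersection poset of the deleted arrangement `𝒜 ∖ {H_{i₀}}`. -/
def memLdel (A : HArr W n) (i₀ : Fin n) (X : AffineSubspace ℂ W) : Prop :=
  X ≠ ⊥ ∧ ∃ S : Finset (Fin n), i₀ ∉ S ∧ A.inter S = X

/-- A maximal element of the intersection poset of the deleted arrangement. -/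
def maximalLdel (A : HArr W n) (i₀ : Fin n) (X : AffineSubspace ℂ W) : Prop :=
  A.memLdel i₀ X ∧ ∀ Y, A.memLdel i₀ Y → Y ≤ X → Y = X

/-- The generator `e_i` of the exterior algebra `E`. -/
def gen (i : Fin n) : ExteriorAlgebra ℂ (Fin n → ℂ) :=
  ExteriorAlgebra.ι ℂ (Pi.single i 1)

/-- `e_S = e_{i_1} ∧ ⋯ ∧ e_{i_p}` for `S = {i_1 < ⋯ < i_p}`. -/
def eS (S : Finset (Fin n)) : ExteriorAlgebra ℂ (Fin n → ℂ) :=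
  ((S.sort (· ≤ ·)).map gen).prod

/-- `∂e_S = Σ_k (−1)^{k−1} e_{S ∖ {i_k}}`. -/
def bdry (S : Finset (Fin n)) : ExteriorAlgebra ℂ (Fin n → ℂ) :=
  ∑ i ∈ S, ((-1 : ℂ) ^ (S.filter fun j => j < i).card) • eS (S.erase i)

/-- The defining relations of the Orlik–Solomon algebra. -/
inductive OSRel (A : HArr W n) :
    ExteriorAlgebra ℂ (Fin n → ℂ) → ExteriorAlgebra ℂ (Fin n → ℂ) → Prop
  | isBot : ∀ S : Finset (Fin n), A.inter S = ⊥ → OSRel A (eS S) 0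
  | isDep : ∀ S : Finset (Fin n), A.dep S → OSRel A (bdry S) 0

/-- The Orlik–Solomon algebra `A(𝒜)`: the exterior algebra modulo the ideal generated by
the `e_S` with empty intersection and the `∂e_S` with `S` dependent. -/
abbrev OS (A : HArr W n) := RingQuot (OSRel A)

/-- The quotient map `E → A(𝒜)`. -/
def osMk (A : HArr W n) : ExteriorAlgebra ℂ (Fin n → ℂ) →ₐ[ℂ] OS A :=
  RingQuot.mkAlgHom ℂ (OSRel A)

/-- `ω_i`, the image of `e_i` in the Orlik–Solomon algebra. -/
def om (A : HArr W n) (i : Fin n) : OS A := osMk A (gen i)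

/-- `ω_B`, the image of `e_B` in the Orlik–Solomon algebra. -/
def omB (A : HArr W n) (S : Finset (Fin n)) : OS A := osMk A (eS S)

/-- The degree `p` part `A^p` of the Orlik–Solomon algebra. -/
def deg (A : HArr W n) (p : ℕ) : Submodule ℂ (OS A) :=
  Submodule.span ℂ {x | ∃ S : Finset (Fin n), S.card = p ∧ x = omB A S}

/-- `ω_λ = Σ_i λ_i ω_i`. -/
def omLam (A : HArr W n) (lam : Fin n → ℂ) : OS A := ∑ i, lam i • om A i

/-- `ω_λ(X) = Σ_{H_i ∈ 𝒜_X} λ_i ω_i`. -/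
def omLamX (A : HArr W n) (lam : Fin n → ℂ) (X : AffineSubspace ℂ W) : OS A :=
  ∑ i ∈ A.sub X, lam i • om A i

/-- The form `Ξ(B) = ω_λ(X_1) ⋯ ω_λ(X_r)` attached to a standard ordered base. -/
def Xi (A : HArr W n) (σ : Equiv.Perm (Fin n)) (lam : Fin n → ℂ) (S : Finset (Fin n)) :
    OS A :=
  ((List.finRange S.card).map fun p => A.omLamX lam (A.flag σ S p)).prod

/-- The submodule `ω_λ ∧ A^p` of the Orlik-Solomon algebra. -/
def Ideg (A : HArr W n) (lam : Fin n → ℂ) (p : ℕ) : Submodule ℂ (OS A) :=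
  (A.deg p).map (LinearMap.mulLeft ℂ (A.omLam lam))

end HArr

section Lex

variable {α : Type*} [LinearOrder α]

/-- If a strictly increasing list precedes another lexicographically, then either it is contained
in the other one or its first entry outside the other list is where the two lists split. -/
theorem List.Lex.subset_or_exists_first_diff {l₁ l₂ : List α} (h : List.Lex (· < ·) l₁ l₂)
    (h₁ : l₁.Pairwise (· < ·)) (h₂ : l₂.Pairwise (· < ·)) :
    l₁ ⊆ l₂ ∨ ∃ k ∈ l₁, k ∉ l₂ ∧ ∀ y < k, y ∈ l₁ ↔ y ∈ l₂ := by
  induction h with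
  | nil => exact Or.inl (List.nil_subset _)
  | @cons a l₁ l₂ _ ih =>
    rw [List.pairwise_cons] at h₁ h₂
    rcases ih h₁.2 h₂.2 with hs | ⟨k, hk, hk', hlt⟩
    · exact Or.inl (List.cons_subset_cons _ hs)
    · have hak := h₁.1 k hk
      refine Or.inr ⟨k, List.mem_cons_of_mem _ hk, ?_, fun y hy => ?_⟩
      · simp [hak.ne', hk']
      · simp [hlt y hy]
  | @rel a l₁ b l₂ hab =>
    rw [List.pairwise_cons] at h₁ h₂
    refine Or.inr ⟨a, List.mem_cons_self, ?_, fun y hy => ?_⟩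
    · intro ha
      rcases List.mem_cons.1 ha with rfl | ha
      · exact lt_irrefl _ hab
      · exact lt_asymm hab (h₂.1 _ ha)
    · refine iff_of_false (fun hm => ?_) (fun hm => ?_)
      · rcases List.mem_cons.1 hm with rfl | hm
        · exact lt_irrefl _ hy
        · exact lt_asymm hy (h₁.1 _ hm)
      · rcases List.mem_cons.1 hm with rfl | hm
        · exact lt_asymm hy hab
        · exact lt_asymm (hy.trans hab) (h₂.1 _ hm)

end Lex

section LinearAlgebra

variable {K V ι : Type*} [Field K] [AddCommGroup V] [Module K V]

/-- Linearly independent functionals attain arbitrary values simultaneously. -/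
theorem LinearIndepOn.exists_forall_apply_eq [FiniteDimensional K V] {α : ι → Dual K V}
    {s : Set ι} (h : LinearIndepOn K α s) (c : ι → K) : ∃ v, ∀ i ∈ s, α i v = c i := by
  obtain ⟨φ, hφ⟩ := LinearMap.exists_extend ((Basis.span h).constr K fun i : s => c i)
  refine ⟨(evalEquiv K V).symm φ, fun i hi => ?_⟩
  have hb : ((Basis.span h ⟨i, hi⟩ : Submodule.span K _) : Dual K V) = α i :=
    congrArg Subtype.val (Basis.span_apply h ⟨i, hi⟩)
  have := LinearMap.congr_fun hφ (Basis.span h ⟨i, hi⟩)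
  rw [Basis.constr_basis, LinearMap.comp_apply, Submodule.subtype_apply, hb] at this
  rw [← this, apply_evalEquiv_symm_apply]

/-- A vector outside the span of part of an independent family, but in the span of the whole family,
is outside the span of the family with one suitable further member removed. -/
theorem LinearIndepOn.exists_notMem_span_diff_singleton {α : ι → V} {s t : Set ι}
    (h : LinearIndepOn K α s) {x : V} (hx : x ∈ Submodule.span K (α '' s))
    (ht : x ∉ Submodule.span K (α '' (s ∩ t))) :
    ∃ b ∈ s, b ∉ t ∧ x ∉ Submodule.span K (α '' (s \ {b})) := by
  by_contra! hc
  obtain ⟨f, hf, rfl⟩ := (Finsupp.mem_span_image_iff_linearCombination K).1 hx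
  refine ht ((Finsupp.mem_span_image_iff_linearCombination K).2 ⟨f, ?_, rfl⟩)
  rw [Finsupp.mem_supported] at hf ⊢
  intro b hb
  refine ⟨hf hb, by_contra fun hbt => ?_⟩
  obtain ⟨g, hg, hgf⟩ := (Finsupp.mem_span_image_iff_linearCombination K).1 (hc b (hf hb) hbt)
  have hfg : g = f := linearIndepOn_iffₛ.1 h g (Finsupp.supported_mono Set.sdiff_subset hg) f
    ((Finsupp.mem_supported _ _).2 hf) hgf
  rw [Finsupp.mem_supported, hfg] at hg
  exact (hg hb).2 rfl

end LinearAlgebra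

namespace HArr

variable {W : Type} [AddCommGroup W] [Module ℂ W] {n : ℕ}

theorem lexLt.subset_or_exists_first_diff {S T : Finset (Fin n)} (h : lexLt S T) :
    S ⊆ T ∨ ∃ k ∈ S, k ∉ T ∧ ∀ y < k, y ∈ S ↔ y ∈ T := by
  have := List.Lex.subset_or_exists_first_diff h S.sortedLT_sort.pairwise T.sortedLT_sort.pairwise
  simpa [List.subset_def, Finset.subset_iff] using this

theorem lexLt_irrefl (S : Finset (Fin n)) : ¬ lexLt S S := fun h =>
  asymm_of (List.Lex (· < ·)) h h

/-- Replacing an element by a smaller new one makes a set lexicographically smaller. -/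
theorem lexLt_insert_erase {S : Finset (Fin n)} {b x : Fin n} (hb : b ∈ S) (hx : x ∉ S)
    (hxb : x < b) : lexLt (insert x (S.erase b)) S := by
  have hne : b ≠ x := hxb.ne'
  rcases trichotomous_of (List.Lex (· < ·)) ((insert x (S.erase b)).sort (· ≤ ·))
    (S.sort (· ≤ ·)) with h | h | h
  · exact h
  · have := congrArg (x ∈ ·) h
    simp [hx] at this
  · rcases lexLt.subset_or_exists_first_diff (S := S) h with hs | ⟨k, hk, hk', hlt⟩
    · simpa [hne] using hs hb
    · obtain rfl : k = b := by
        by_contra hkb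
        exact hk' (by simp [hkb, hk])
      exact absurd ((hlt x hxb).2 (by simp)) hx

theorem exists_normal [FiniteDimensional ℂ W] (A : HArr W n) (i : Fin n) :
    ∃ f : Dual ℂ A.amb.direction, ∀ v : A.amb.direction,
      f v = 0 ↔ (v : W) ∈ (A.H i).direction := by
  set D := (A.H i).direction.comap A.amb.direction.subtype with hD
  have hle : (A.H i).direction ≤ A.amb.direction := AffineSubspace.direction_le (A.le_amb i)
  have hfin : finrank ℂ D + 1 = finrank ℂ A.amb.direction := by
    rw [← A.hyp i, hD, (Submodule.comapSubtypeEquivOfLe hle).finrank_eq]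
  have hlt : D < ⊤ := by
    refine lt_top_iff_ne_top.2 fun h => ?_
    rw [h, finrank_top] at hfin
    omega
  obtain ⟨f, hf, hker⟩ := D.exists_le_ker_of_lt_top hlt
  have heq : D = LinearMap.ker f := by
    refine Submodule.eq_of_le_of_finrank_eq hker ?_
    have := Module.Dual.finrank_ker_add_one_of_ne_zero hf
    omega
  refine ⟨f, fun v => ?_⟩
  rw [← LinearMap.mem_ker, ← heq]
  rfl

/-- A linear functional on the direction of the ambient space whose kernel is the direction of
the `i`-th hyperplane. -/
def normal [FiniteDimensional ℂ W] (A : HArr W n) (i : Fin n) : Dual ℂ A.amb.direction :=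
  (A.exists_normal i).choose

theorem mem_inter (A : HArr W n) {S : Finset (Fin n)} {x : W} :
    x ∈ A.inter S ↔ x ∈ A.amb ∧ ∀ i ∈ S, x ∈ A.H i := by
  simp only [inter, Finset.inf_eq_iInf, AffineSubspace.mem_inf_iff, AffineSubspace.mem_iInf_iff]

theorem inter_anti (A : HArr W n) {S T : Finset (Fin n)} (h : S ⊆ T) : A.inter T ≤ A.inter S :=
  inf_le_inf_left _ (Finset.inf_mono h)

theorem nbcSet.mono {A : HArr W n} {S T : Finset (Fin n)} {σ : Equiv.Perm (Fin n)}
    (hT : A.nbcSet σ T) (h : S ⊆ T) : A.nbcSet σ S :=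
  ⟨fun hb => hT.1 (le_bot_iff.1 (hb ▸ A.inter_anti h)), fun U hU => hT.2 U (hU.trans h)⟩

variable [FiniteDimensional ℂ W] (A : HArr W n)

theorem normal_apply_eq_zero (i : Fin n) (v : A.amb.direction) :
    A.normal i v = 0 ↔ (v : W) ∈ (A.H i).direction :=
  (A.exists_normal i).choose_spec v

theorem cd_inter {S : Finset (Fin n)} (hS : A.inter S ≠ ⊥) :
    A.cd (A.inter S) = finrank ℂ (Submodule.span ℂ (A.normal '' S)) := by
  obtain ⟨q, hq⟩ := (AffineSubspace.nonempty_iff_ne_bot _).2 hS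
  have hq' := A.mem_inter.1 hq
  have hdir : (A.inter S).direction =
      (Submodule.span ℂ (A.normal '' S)).dualCoannihilator.map A.amb.direction.subtype := by
    ext v
    rw [← AffineSubspace.vadd_mem_iff_mem_direction v hq, mem_inter,
      AffineSubspace.vadd_mem_iff_mem_direction v hq'.1]
    have key (w : A.amb.direction) : w ∈ (Submodule.span ℂ (A.normal '' S)).dualCoannihilator ↔
        ∀ i ∈ S, (w : W) +ᵥ q ∈ A.H i := by
      rw [← SetLike.mem_coe, Submodule.coe_dualCoannihilator_span]
      simp only [Set.mem_ofPred_eq, Set.forall_mem_image, Finset.mem_coe, normal_apply_eq_zero]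
      exact forall₂_congr fun i hi =>
        (AffineSubspace.vadd_mem_iff_mem_direction _ (hq'.2 i hi)).symm
    constructor
    · rintro ⟨hv, h⟩
      exact ⟨⟨v, hv⟩, (key _).2 h, rfl⟩
    · rintro ⟨w, hw, rfl⟩
      exact ⟨w.2, (key w).1 hw⟩
  have := Subspace.finrank_add_finrank_dualCoannihilator_eq (Submodule.span ℂ (A.normal '' S))
  rw [cd, hdir, Submodule.finrank_map_subtype_eq]
  omega

theorem linearIndepOn_normal_iff {S : Finset (Fin n)} :
    LinearIndepOn ℂ A.normal (S : Set (Fin n)) ↔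
      finrank ℂ (Submodule.span ℂ (A.normal '' S)) = S.card := by
  rw [LinearIndepOn, linearIndependent_iff_card_eq_finrank_span, Set.finrank,
    ← Set.image_eq_range, eq_comm]
  simp

theorem inter_ne_bot_of_linearIndepOn {S : Finset (Fin n)}
    (h : LinearIndepOn ℂ A.normal (S : Set (Fin n))) : A.inter S ≠ ⊥ := by
  obtain ⟨p, hp⟩ := A.amb_ne
  choose q hq using A.nonemptyH
  obtain ⟨v, hv⟩ := h.exists_forall_apply_eq fun i =>
    A.normal i ⟨q i -ᵥ p, AffineSubspace.vsub_mem_direction (A.le_amb i (hq i)) hp⟩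
  refine (AffineSubspace.nonempty_iff_ne_bot _).1 ⟨(v : W) +ᵥ p, A.mem_inter.2
    ⟨AffineSubspace.vadd_mem_of_mem_direction v.2 hp, fun i hi => ?_⟩⟩
  have h0 := sub_eq_zero.2 (hv i hi)
  rw [← map_sub, normal_apply_eq_zero] at h0
  have := AffineSubspace.vadd_mem_of_mem_direction h0 (hq i)
  convert! this using 1
  simp [vadd_eq_add, vsub_eq_sub, sub_eq_add_neg, add_assoc]

theorem indep_iff {S : Finset (Fin n)} :
    A.indep S ↔ LinearIndepOn ℂ A.normal (S : Set (Fin n)) := by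
  refine ⟨fun h => ?_, fun h => ⟨A.inter_ne_bot_of_linearIndepOn h, ?_⟩⟩
  · rw [linearIndepOn_normal_iff, ← A.cd_inter h.1, h.2]
  · rw [A.cd_inter (A.inter_ne_bot_of_linearIndepOn h), ← linearIndepOn_normal_iff]
    exact h

theorem dep_iff {S : Finset (Fin n)} :
    A.dep S ↔ A.inter S ≠ ⊥ ∧ ¬ LinearIndepOn ℂ A.normal (S : Set (Fin n)) := by
  refine and_congr_right fun hS => ?_
  have : finrank ℂ (Submodule.span ℂ (A.normal '' S)) ≤ S.card := by
    classical
    have := finrank_span_finset_le_card (R := ℂ) (S.image A.normal)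
    rw [Finset.coe_image] at this
    exact this.trans Finset.card_image_le
  rw [A.cd_inter hS, linearIndepOn_normal_iff]
  omega

variable {A}

theorem isBase.normal_mem_span {B : Finset (Fin n)} (hB : A.isBase B) (x : Fin n) :
    A.normal x ∈ Submodule.span ℂ (A.normal '' B) := by
  by_contra hx
  have hxB : x ∉ B := fun h => hx (Submodule.subset_span ⟨x, h, rfl⟩)
  have h := (A.indep_iff.1 hB.1).insert hx
  rw [← Finset.coe_insert, ← indep_iff] at h
  exact hxB (hB.2 _ h (Finset.subset_insert _ _) ▸ Finset.mem_insert_self _ _)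

theorem isBase.card_le {B T : Finset (Fin n)} (hB : A.isBase B) (hT : A.indep T) :
    T.card ≤ B.card := by
  rw [← A.linearIndepOn_normal_iff.1 (A.indep_iff.1 hB.1),
    ← A.linearIndepOn_normal_iff.1 (A.indep_iff.1 hT)]
  refine Submodule.finrank_mono (Submodule.span_le.2 ?_)
  rintro _ ⟨i, -, rfl⟩
  exact hB.normal_mem_span i

theorem isBase.of_card_eq {B T : Finset (Fin n)} (hB : A.isBase B) (hT : A.indep T)
    (h : T.card = B.card) : A.isBase T :=
  ⟨hT, fun _ hU hTU => Finset.eq_of_subset_of_card_le hTU (h ▸ hB.card_le hU)⟩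

/-- The normal of each member of a circuit depends on the normals of the other members. -/
theorem circuit.normal_mem_span {D : Finset (Fin n)} (hD : A.circuit D) {x : Fin n} (hx : x ∈ D) :
    A.normal x ∈ Submodule.span ℂ (A.normal '' (D.erase x : Finset (Fin n))) := by
  by_contra h
  have hne := (A.dep_iff.1 hD.1).1
  have hE : LinearIndepOn ℂ A.normal (D.erase x : Finset (Fin n)) := by
    by_contra hc
    refine hD.2 _ (Finset.erase_ssubset hx) (A.dep_iff.2 ⟨fun hb => hne ?_, hc⟩)
    exact le_bot_iff.1 (hb ▸ A.inter_anti (Finset.erase_subset _ _))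
  have := hE.insert h
  rw [← Finset.coe_insert, Finset.insert_erase hx] at this
  exact (A.dep_iff.1 hD.1).2 this

/-- Adjoining to an nbc set the smallest hyperplane not in its span creates no broken circuit. -/
theorem nbcSet.insert {F : Finset (Fin n)} {x : Fin n} (hF : A.nbcSet 1 F)
    (hFx : A.inter (insert x F) ≠ ⊥)
    (hx : A.normal x ∉ Submodule.span ℂ (A.normal '' F))
    (hmin : ∀ m < x, A.normal m ∈ Submodule.span ℂ (A.normal '' F)) :
    A.nbcSet 1 (insert x F) := by
  refine ⟨hFx, fun T hT hbc => ?_⟩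
  have hxT : x ∈ T := by
    by_contra hxT
    exact hF.2 T ((Finset.subset_insert_iff_of_notMem hxT).1 hT) hbc
  obtain ⟨m, -, hmT, hcirc⟩ := hbc
  have hmx : m < x := hmT x hxT
  refine hx (Submodule.span_le.2 ?_ (hcirc.normal_mem_span (Finset.mem_insert_of_mem hxT)))
  rintro _ ⟨i, hi, rfl⟩
  obtain ⟨hix, hi⟩ := Finset.mem_erase.1 hi
  rcases Finset.mem_insert.1 hi with rfl | hi
  · exact hmin _ hmx
  · exact Submodule.subset_span ⟨i, Finset.mem_of_mem_insert_of_ne (hT hi) hix, rfl⟩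

end HArr

open scoped Classical
/-- The lexicographic ordering of the standard ordered nbc-bases is a
shelling order of the broken circuit complex. -/
theorem lex_shelling {W : Type} [AddCommGroup W] [Module ℂ W] [FiniteDimensional ℂ W]
    {n : ℕ} (A : HArr W n) (B B' : Finset (Fin n))
    (hB : A.nbcBase 1 B) (hB' : A.nbcBase 1 B') (hlt : HArr.lexLt B' B) :
    ∃ (B'' : Finset (Fin n)) (i : Fin n), A.nbcBase 1 B'' ∧ HArr.lexLt B'' B ∧
      i ∈ B \ B' ∧ B ∩ B' ⊆ B.erase i ∧ B ∩ B'' = B.erase i := by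
  obtain ⟨k, hkB', hkB, hlt'⟩ : ∃ k ∈ B', k ∉ B ∧ ∀ y < k, y ∈ B' ↔ y ∈ B := by
    refine hlt.subset_or_exists_first_diff.resolve_left fun hs => ?_
    rw [hB'.2.2 B hB.2.1 hs] at hlt
    exact HArr.lexLt_irrefl _ hlt
  have hBi := A.indep_iff.1 hB.2.1
  have hsub : (B ∩ B' : Set (Fin n)) ⊆ B' \ {k} := fun y hy =>
    ⟨hy.2, fun h => hkB (Set.mem_singleton_iff.1 h ▸ hy.1)⟩
  obtain ⟨b, hb, hbB', hkb⟩ := hBi.exists_notMem_span_diff_singleton (t := (B' : Set (Fin n)))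
    (hB.2.normal_mem_span k) fun hk =>
      (A.indep_iff.1 hB'.2.1).notMem_span hkB' (Submodule.span_mono (Set.image_mono hsub) hk)
  rw [← Finset.coe_erase] at hkb
  rw [Finset.mem_coe] at hb hbB'
  have hkltb : k < b := by
    rcases lt_trichotomy k b with h | rfl | h
    · exact h
    · exact absurd hb hkB
    · exact absurd ((hlt' b h).2 hb) hbB'
  set F := B.erase b with hF
  obtain ⟨x, hx, hmin⟩ := WellFounded.has_min (wellFounded_lt (α := Fin n))
    {x | A.normal x ∉ Submodule.span ℂ (A.normal '' F)} ⟨k, hkb⟩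
  have hxb : x < b := (not_lt.1 (hmin k hkb)).trans_lt hkltb
  have hxF : x ∉ F := fun h => hx (Submodule.subset_span ⟨x, h, rfl⟩)
  have hxB : x ∉ B := fun h => hxF (Finset.mem_erase.2 ⟨hxb.ne, h⟩)
  have hFi : LinearIndepOn ℂ A.normal (F : Set (Fin n)) := hBi.mono (Finset.erase_subset b B)
  have hi : A.indep (insert x F) := by
    rw [HArr.indep_iff, Finset.coe_insert]
    exact hFi.insert hx
  have hcard : (insert x F).card = B.card := by
    rw [Finset.card_insert_of_notMem hxF, Finset.card_erase_add_one hb]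
  refine ⟨insert x F, b, ⟨?_, hB.2.of_card_eq hi hcard⟩, HArr.lexLt_insert_erase hb hxB hxb,
    Finset.mem_sdiff.2 ⟨hb, hbB'⟩, fun y hy => ?_, ?_⟩
  · exact (hB.1.mono (Finset.erase_subset b B)).insert hi.1 hx
      fun m hm => by_contra fun h => hmin m h hm
  · rw [Finset.mem_inter] at hy
    exact Finset.mem_erase.2 ⟨fun h => hbB' (h ▸ hy.2), hy.1⟩
  · rw [Finset.inter_insert_of_notMem hxB, Finset.inter_eq_right]
    exact Finset.erase_subset b B
end
end

section
/- For every chain X_0 > X_1 > ⋯ > X_p of elements of L ∖ {V} (i.e. X_0 ⊊ X_1 ⊊ ⋯ ⊊ X_p as subspaces), the set {min 𝒜_{X_0}, min 𝒜_{X_1}, …, min 𝒜_{X_p}} (minima taken with respect to the linear order on 𝒜) is an nbc set of 𝒜. In other words, the vertex map X ↦ min 𝒜_X carries simplices of the Folkman complex (chains in L ∖ {V}) to simplices of the broken circuit complex. -/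
open Module

noncomputable section

namespace HArr

variable {W : Type} [AddCommGroup W] [Module ℂ W] {n : ℕ}

theorem inter_le (A : HArr W n) {S : Finset (Fin n)} {i : Fin n} (h : i ∈ S) :
    A.inter S ≤ A.H i :=
  inf_le_right.trans (Finset.inf_le h)

/-- Every hyperplane of a circuit contains the intersection of the others. -/
theorem inter_le_of_circuit_insert [FiniteDimensional ℂ W] (A : HArr W n)
    {T : Finset (Fin n)} {i : Fin n} (hi : i ∉ T) (hC : A.circuit (insert i T)) :
    A.inter T ≤ A.H i := by
  obtain ⟨⟨hne, hcd⟩, hmin⟩ := hC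
  have hle : A.inter (insert i T) ≤ A.inter T := A.inter_anti (Finset.subset_insert i T)
  have hTne : A.inter T ≠ ⊥ := ne_bot_of_le_ne_bot hne hle
  have hT : T.card ≤ A.cd (A.inter T) := by
    by_contra! h
    exact hmin T (Finset.ssubset_insert hi) ⟨hTne, h⟩
  rw [Finset.card_insert_of_notMem hi] at hcd
  have hamb : finrank ℂ (A.inter T).direction ≤ finrank ℂ A.amb.direction :=
    Submodule.finrank_mono (AffineSubspace.direction_le inf_le_left)
  have hdir := AffineSubspace.direction_le hle
  have hrank := Submodule.finrank_mono hdir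
  have heq : (A.inter (insert i T)).direction = (A.inter T).direction := by
    refine Submodule.eq_of_le_of_finrank_eq hdir ?_
    unfold cd at hcd hT
    omega
  have : A.inter (insert i T) = A.inter T :=
    AffineSubspace.eq_of_direction_eq_of_nonempty_of_le heq
      ((AffineSubspace.nonempty_iff_ne_bot _).2 hne) hle
  exact this ▸ A.inter_le (Finset.mem_insert_self i T)

theorem not_amb_le (A : HArr W n) (i : Fin n) : ¬ A.amb ≤ A.H i := fun h => by
  have := A.hyp i
  rw [le_antisymm (A.le_amb i) h] at this
  omega

theorem le_of_memL (A : HArr W n) {X : AffineSubspace ℂ W} (h : A.memL X) : X ≤ A.amb := by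
  obtain ⟨-, S, rfl⟩ := h
  exact inf_le_left

theorem le_of_isMin_sub (A : HArr W n) {X : AffineSubspace ℂ W} {σ : Equiv.Perm (Fin n)}
    {i : Fin n} (h : isMin σ i (A.sub X)) : X ≤ A.H i := by
  simpa [sub] using h.1

end HArr

open scoped Classical
/-- For every chain `X_0 > X_1 > ⋯ > X_p` in `L ∖ {V}`, the set of
minima `{min 𝒜_{X_0}, …, min 𝒜_{X_p}}` is an nbc set: the vertex map `X ↦ min 𝒜_X`
carries simplices of the Folkman complex to simplices of the broken circuit complex. -/
theorem min_chain_nbcSet {W : Type} [AddCommGroup W] [Module ℂ W]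
    [FiniteDimensional ℂ W] {n : ℕ} (A : HArr W n) (p : ℕ)
    (X : Fin (p + 1) → AffineSubspace ℂ W)
    (hL : ∀ k, A.memL (X k) ∧ X k ≠ A.amb)
    (hchain : ∀ k l : Fin (p + 1), k < l → X k < X l)
    (mn : Fin (p + 1) → Fin n)
    (hmn : ∀ k, HArr.isMin 1 (mn k) (A.sub (X k))) :
    A.nbcSet 1 (Finset.univ.image mn) := by
  have hmono : Monotone X := (show StrictMono X from fun k l => hchain k l).monotone
  refine ⟨ne_bot_of_le_ne_bot (hL 0).1.1 (le_inf (A.le_of_memL (hL 0).1) ?_), ?_⟩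
  · refine Finset.le_inf fun i hi => ?_
    obtain ⟨k, -, rfl⟩ := Finset.mem_image.1 hi
    exact (hmono (Fin.zero_le k)).trans (A.le_of_isMin_sub (hmn k))
  · rintro T hT ⟨i, hi, hlt, hC⟩
    have hTi := A.inter_le_of_circuit_insert hi hC
    have hex : (Finset.univ.filter fun k => mn k ∈ T).Nonempty := by
      obtain rfl | ⟨t, ht⟩ := T.eq_empty_or_nonempty
      · exact absurd (by simpa [HArr.inter] using hTi) (A.not_amb_le i)
      · obtain ⟨k, -, rfl⟩ := Finset.mem_image.1 (hT ht)
        exact ⟨k, by simpa using ht⟩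
    obtain ⟨k, hk, hkmin⟩ := Finset.exists_min_image _ id hex
    have hXT : X k ≤ A.inter T := by
      refine le_inf (A.le_of_memL (hL k).1) (Finset.le_inf fun t ht => ?_)
      obtain ⟨l, -, rfl⟩ := Finset.mem_image.1 (hT ht)
      exact (hmono (hkmin l (by simpa using ht))).trans (A.le_of_isMin_sub (hmn l))
    have hiX : i ∈ A.sub (X k) := by simpa [HArr.sub] using hXT.trans hTi
    exact ((hmn k).2 i hiX).not_gt (hlt _ (by simpa using hk))
end
end
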